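/- Let v : ℕ → ℕ satisfy v(n) ≥ 1 for all n and v(n)/log n → 0. Then for every M > 0 and every ε > 0 there is N such that for all n ≥ N and all t ∈ ℝ with |t| ≤ M·(log n)^{1/4}, writing h_n = h_n(t) and L_n² = (√(n+v)/√n)·(1+h_n)², one has | n·φ(L_n²) − 2n·(1 + 2h_n²) | ≤ ε/log n. -/

import Mathlib

open Filter Topology

noncomputable section

/-- `s_n = 4n(n+v)/(2n+v)`. -/
def sSeq (v : ℕ → ℕ) (n : ℕ) : ℝ := 4 * n * (n + v n) / (2 * n + v n)

/-- `γ_n = (1/2) log s_n − (5/4) log log s_n − log (2^{1/4} π)`. -/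
def gammaSeq (v : ℕ → ℕ) (n : ℕ) : ℝ :=
  (1/2) * Real.log (sSeq v n) - (5/4) * Real.log (Real.log (sSeq v n)) -
    Real.log ((2:ℝ) ^ ((1:ℝ)/4) * Real.pi)

/-- `h_n(t) = (γ_n + t)/√(2 s_n log s_n)`. -/
def hSeq (v : ℕ → ℕ) (n : ℕ) (t : ℝ) : ℝ :=
  (gammaSeq v n + t) / Real.sqrt (2 * sSeq v n * Real.log (sSeq v n))

/-- `φ(r) = 2r − (2 + (v + 1/2)/n) log r`. -/
def phiFun (v : ℕ → ℕ) (n : ℕ) (r : ℝ) : ℝ :=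
  2 * r - (2 + ((v n : ℝ) + 1/2) / n) * Real.log r

/-- `L_n² = (√(n+v)/√n)(1+h_n)²`. -/
def LnSq (v : ℕ → ℕ) (n : ℕ) (t : ℝ) : ℝ :=
  Real.sqrt ((n : ℝ) + v n) / Real.sqrt n * (1 + hSeq v n t) ^ 2

lemma abs_sqrt_one_add_sub_le {a : ℝ} (h0 : 0 ≤ a) (h1 : a ≤ 1) :
    |√(1 + a) - (1 + a / 2)| ≤ a ^ 2 / 2 := by
  have hub : √(1 + a) ≤ 1 + a / 2 := Real.sqrt_le_iff.2 ⟨by linarith, by nlinarith⟩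
  have hlb : 1 + a / 2 - a ^ 2 / 2 ≤ √(1 + a) := by
    apply Real.le_sqrt_of_sq_le
    have : 0 ≤ a ^ 2 * (3 / 4 + a / 2 - a ^ 2 / 4) := mul_nonneg (sq_nonneg a) (by nlinarith)
    nlinarith
  rw [abs_le]
  constructor <;> nlinarith

lemma abs_log_one_add_sub_self_le {a : ℝ} (h0 : 0 ≤ a) : |Real.log (1 + a) - a| ≤ a ^ 2 := by
  have hub := Real.log_le_sub_one_of_pos (show 0 < 1 + a by linarith)
  have hlb := Real.one_sub_inv_le_log_of_pos (show 0 < 1 + a by linarith)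
  have hinv : (1 + a)⁻¹ ≤ 1 - a + a ^ 2 := by
    rw [inv_le_iff_one_le_mul₀ (by linarith)]
    nlinarith [pow_nonneg h0 3]
  rw [abs_le]
  constructor <;> nlinarith

lemma abs_log_one_add_sub_quadratic_le {h : ℝ} (hh : |h| ≤ 1 / 2) :
    |Real.log (1 + h) - (h - h ^ 2 / 2)| ≤ 2 * |h| ^ 3 := by
  have key := Real.abs_log_sub_add_sum_range_le (x := -h) (by rw [abs_neg]; linarith) 2
  simp only [Finset.sum_range_succ, Finset.sum_range_zero, abs_neg, sub_neg_eq_add] at key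
  norm_num at key
  calc _ = |-h + h ^ 2 / 2 + Real.log (1 + h)| := by congr 1; ring
    _ ≤ |h| ^ 3 / (1 - |h|) := key
    _ ≤ 2 * |h| ^ 3 := by
      rw [div_le_iff₀ (by linarith)]
      nlinarith [pow_nonneg (abs_nonneg h) 3]

/-- Quantitative second-order expansion: with `r = √(1 + w/x) (1 + h)²`, the quantity
`x (2 r - (2 + (w + 1/2)/x) log r)` is close to `2 x (1 + 2 h²)`. -/
lemma abs_quadratic_expansion_le {x w h K l : ℝ} (hx : 1 ≤ x) (hw0 : 0 ≤ w) (hwx : w ≤ x)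
    (hwl : w ≤ l) (hl : 1 ≤ l) (hK : 1 ≤ K) (hh : |h| ≤ 1 / 2) (hhK : |h| ≤ K * (l / √x)) :
    |x * (2 * (√(1 + w / x) * (1 + h) ^ 2) -
        (2 + (w + 1 / 2) / x) * Real.log (√(1 + w / x) * (1 + h) ^ 2)) -
      2 * x * (1 + 2 * h ^ 2)| ≤ 25 * K ^ 3 * (l ^ 3 / √x) := by
  have hx0 : 0 < x := by linarith
  have ha0 : 0 ≤ w / x := by positivity
  have ha1 : w / x ≤ 1 := (div_le_one hx0).2 hwx
  obtain ⟨hh1, hh2⟩ := abs_le.1 hh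
  have hA := abs_sqrt_one_add_sub_le ha0 ha1
  have hB := abs_log_one_add_sub_self_le ha0
  have hD := abs_log_one_add_sub_quadratic_le hh
  have hlog : Real.log (√(1 + w / x) * (1 + h) ^ 2) =
      Real.log (1 + w / x) / 2 + 2 * Real.log (1 + h) := by
    have h1 : (0 : ℝ) < 1 + h := by linarith
    rw [Real.log_mul (by positivity) (by positivity), Real.log_sqrt (by positivity),
      Real.log_pow]
    norm_num
  rw [hlog]
  set A := √(1 + w / x) - (1 + w / x / 2) with hAdef
  set B := Real.log (1 + w / x) - w / x with hBdef
  set D := Real.log (1 + h) - (h - h ^ 2 / 2) with hDdef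
  have hid : x * (2 * (√(1 + w / x) * (1 + h) ^ 2) -
        (2 + (w + 1 / 2) / x) * (Real.log (1 + w / x) / 2 + 2 * Real.log (1 + h))) -
      2 * x * (1 + 2 * h ^ 2) =
      2 * x * A * (1 + h) ^ 2 + 2 * w * h ^ 2 - h + h ^ 2 / 2 - (w + 1 / 2) * (w / x) / 2
        - (2 * x + w + 1 / 2) * (B / 2 + 2 * D) := by
    rw [show √(1 + w / x) = A + (1 + w / x / 2) by rw [hAdef]; ring,
      show Real.log (1 + w / x) = B + w / x by rw [hBdef]; ring,
      show Real.log (1 + h) = D + (h - h ^ 2 / 2) by rw [hDdef]; ring]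
    field_simp
    ring
  rw [hid]
  have hq : 1 ≤ √x := Real.one_le_sqrt.2 hx
  have hqx : x = √x ^ 2 := (Real.sq_sqrt hx0.le).symm
  set q := √x
  set e := l ^ 3 / q with hedef
  have he0 : 0 ≤ e := by positivity
  have hlq : l / q ≤ e := by
    rw [hedef]; gcongr; exact le_self_pow₀ hl (by norm_num)
  have hl2 : l ^ 2 / x ≤ e := by
    rw [hedef, hqx]
    exact div_le_div₀ (by positivity) (pow_le_pow_right₀ hl (by norm_num)) (by linarith)
      (le_self_pow₀ hq (by norm_num))
  have hl3 : l ^ 3 / x ≤ e := by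
    rw [hedef, hqx]
    exact div_le_div₀ (by positivity) le_rfl (by linarith) (le_self_pow₀ hq (by norm_num))
  have hh2' : h ^ 2 ≤ K ^ 2 * (l ^ 2 / x) := by
    rw [← sq_abs h]
    calc |h| ^ 2 ≤ (K * (l / q)) ^ 2 := by gcongr
      _ = K ^ 2 * (l ^ 2 / x) := by rw [hqx]; ring
  have hh3 : x * |h| ^ 3 ≤ K ^ 3 * e := by
    calc x * |h| ^ 3 ≤ x * (K * (l / q)) ^ 3 := by gcongr
      _ = K ^ 3 * e := by rw [hedef, hqx]; field_simp
  have hwsq : x * (w / x) ^ 2 ≤ e := by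
    calc x * (w / x) ^ 2 = w ^ 2 / x := by field_simp
      _ ≤ l ^ 2 / x := by gcongr
      _ ≤ e := hl2
  have b1 : |2 * x * A * (1 + h) ^ 2| ≤ 9 / 4 * e := by
    rw [abs_mul, abs_mul, abs_of_nonneg (show 0 ≤ 2 * x by linarith), abs_of_nonneg (sq_nonneg (1 + h))]
    have h94 : (1 + h) ^ 2 ≤ 9 / 4 := by nlinarith
    calc 2 * x * |A| * (1 + h) ^ 2 ≤ 2 * x * ((w / x) ^ 2 / 2) * (9 / 4) := by gcongr
      _ = 9 / 4 * (x * (w / x) ^ 2) := by ring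
      _ ≤ 9 / 4 * e := by gcongr
  have b2 : |2 * w * h ^ 2| ≤ 2 * K ^ 2 * e := by
    rw [abs_of_nonneg (by positivity)]
    calc 2 * w * h ^ 2 ≤ 2 * l * (K ^ 2 * (l ^ 2 / x)) := by gcongr
      _ = 2 * K ^ 2 * (l ^ 3 / x) := by ring
      _ ≤ 2 * K ^ 2 * e := by gcongr
  have b3 : |h| ≤ K * e := hhK.trans (by gcongr)
  have b4 : |h ^ 2 / 2| ≤ K ^ 2 * e / 2 := by
    rw [abs_of_nonneg (by positivity)]
    have : K ^ 2 * (l ^ 2 / x) ≤ K ^ 2 * e := by gcongr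
    linarith
  have b5 : |(w + 1 / 2) * (w / x) / 2| ≤ e := by
    rw [abs_of_nonneg (by positivity)]
    calc (w + 1 / 2) * (w / x) / 2 ≤ (l + l) * (l / x) / 2 := by gcongr; linarith
      _ = l ^ 2 / x := by ring
      _ ≤ e := hl2
  have b6 : |(2 * x + w + 1 / 2) * (B / 2 + 2 * D)| ≤ 2 * e + 16 * (K ^ 3 * e) := by
    rw [abs_mul, abs_of_nonneg (show 0 ≤ 2 * x + w + 1 / 2 by positivity)]
    have hBD : |B / 2 + 2 * D| ≤ (w / x) ^ 2 / 2 + 2 * (2 * |h| ^ 3) := by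
      refine (abs_add_le _ _).trans ?_
      rw [abs_div, abs_mul, abs_two]
      gcongr
    calc (2 * x + w + 1 / 2) * |B / 2 + 2 * D|
        ≤ (4 * x) * ((w / x) ^ 2 / 2 + 2 * (2 * |h| ^ 3)) := by gcongr; linarith
      _ = 2 * (x * (w / x) ^ 2) + 16 * (x * |h| ^ 3) := by ring
      _ ≤ 2 * e + 16 * (K ^ 3 * e) := by gcongr
  have k1 : e ≤ K ^ 3 * e := le_mul_of_one_le_left he0 (one_le_pow₀ hK)
  have k2 : K * e ≤ K ^ 3 * e := by gcongr; exact le_self_pow₀ hK (by norm_num)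
  have k3 : K ^ 2 * e ≤ K ^ 3 * e := by gcongr; norm_num
  rw [abs_le] at *
  constructor <;> linarith

lemma le_sSeq (v : ℕ → ℕ) {n : ℕ} (hn : 0 < n) : (n : ℝ) ≤ sSeq v n := by
  have : (0 : ℝ) < n := by exact_mod_cast hn
  rw [sSeq, le_div_iff₀ (by positivity)]
  nlinarith [(v n).cast_nonneg (α := ℝ)]

lemma sSeq_le (v : ℕ → ℕ) {n : ℕ} (hn : 0 < n) : sSeq v n ≤ 4 * n := by
  have : (0 : ℝ) < n := by exact_mod_cast hn
  rw [sSeq, div_le_iff₀ (by positivity)]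
  nlinarith [(v n).cast_nonneg (α := ℝ)]

lemma abs_hSeq_le (v : ℕ → ℕ) {n : ℕ} {t M : ℝ} (hn : 4 ≤ n) (hl : 1 ≤ Real.log n)
    (hc : |Real.log ((2 : ℝ) ^ ((1 : ℝ) / 4) * Real.pi)| ≤ Real.log n) (hM : 0 ≤ M)
    (ht : |t| ≤ M * Real.log n ^ ((1 : ℝ) / 4)) :
    |hSeq v n t| ≤ (5 + M) * (Real.log n / √n) := by
  have hn0 : 0 < n := by omega
  have hnr : (4 : ℝ) ≤ n := by exact_mod_cast hn
  have hs1 := le_sSeq v hn0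
  have hs2 := sSeq_le v hn0
  have hs0 : 0 < sSeq v n := by linarith
  have hls1 : Real.log n ≤ Real.log (sSeq v n) := Real.log_le_log (by linarith) hs1
  have hls2 : Real.log (sSeq v n) ≤ 2 * Real.log n := by
    calc Real.log (sSeq v n) ≤ Real.log ((n : ℝ) ^ 2) := Real.log_le_log hs0 (by nlinarith)
      _ = 2 * Real.log n := by rw [Real.log_pow]; norm_num
  have hll0 : 0 ≤ Real.log (Real.log (sSeq v n)) := Real.log_nonneg (by linarith)
  have hll1 := Real.log_le_self (show 0 ≤ Real.log (sSeq v n) by linarith)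
  have hpow : Real.log n ^ ((1 : ℝ) / 4) ≤ Real.log n := by
    simpa using Real.rpow_le_rpow_of_exponent_le hl (show (1 : ℝ) / 4 ≤ 1 by norm_num)
  have hnum : |gammaSeq v n + t| ≤ (5 + M) * Real.log n := by
    have ht' : |t| ≤ M * Real.log n := ht.trans (by gcongr)
    rw [gammaSeq]
    rw [abs_le] at hc ht' ⊢
    constructor <;> linarith
  have hden : √n ≤ √(2 * sSeq v n * Real.log (sSeq v n)) := by
    apply Real.sqrt_le_sqrt
    nlinarith
  rw [hSeq, abs_div, abs_of_nonneg (Real.sqrt_nonneg _), ← mul_div_assoc]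
  exact div_le_div₀ (by positivity) hnum (Real.sqrt_pos.2 (by linarith)) hden

lemma tendsto_log_pow_div_sqrt (k : ℕ) :
    Tendsto (fun n : ℕ => Real.log n ^ k / √n) atTop (𝓝 0) := by
  have h := (isLittleO_log_rpow_rpow_atTop (k : ℝ)
    (show (0 : ℝ) < 1 / 2 by norm_num)).tendsto_div_nhds_zero
  simp only [Real.rpow_natCast, ← Real.sqrt_eq_rpow] at h
  exact h.comp tendsto_natCast_atTop_atTop

/-- Asymptotics of `n φ(L_n²)` in the regime `1 ≤ v ≪ log n`. -/
theorem n_phi_LnSq_asymptotics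
    (v : ℕ → ℕ) (hv1 : ∀ n, 1 ≤ v n)
    (hvlog : Tendsto (fun n : ℕ => (v n : ℝ) / Real.log n) atTop (𝓝 0)) :
    ∀ M > 0, ∀ ε > (0:ℝ), ∃ N : ℕ, ∀ n ≥ N, ∀ t : ℝ,
      |t| ≤ M * Real.log n ^ ((1:ℝ)/4) →
      |(n : ℝ) * phiFun v n (LnSq v n t) - 2 * n * (1 + 2 * hSeq v n t ^ 2)| ≤
        ε / Real.log n := by
  intro M hM ε hε
  have hlogtop : Tendsto (fun n : ℕ => Real.log n) atTop atTop :=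
    Real.tendsto_log_atTop.comp tendsto_natCast_atTop_atTop
  have hKpos : 0 < 5 + M := by linarith
  have hsmall : ∀ᶠ n : ℕ in atTop, Real.log n ^ 1 / √n < 1 / (2 * (5 + M)) :=
    (tendsto_log_pow_div_sqrt 1).eventually_lt_const (by positivity)
  have herr : ∀ᶠ n : ℕ in atTop, Real.log n ^ 4 / √n < ε / (25 * (5 + M) ^ 3) :=
    (tendsto_log_pow_div_sqrt 4).eventually_lt_const (by positivity)
  have hv : ∀ᶠ n : ℕ in atTop, (v n : ℝ) / Real.log n < 1 :=
    hvlog.eventually_lt_const one_pos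
  refine eventually_atTop.1 ?_
  filter_upwards [hsmall, herr, hv, hlogtop.eventually_ge_atTop 1,
    hlogtop.eventually_ge_atTop |Real.log ((2 : ℝ) ^ ((1 : ℝ) / 4) * Real.pi)|,
    eventually_ge_atTop 4] with n hsm her hvn hl hc hn t ht
  have hl0 : 0 < Real.log n := by linarith
  have hnr : (4 : ℝ) ≤ n := by exact_mod_cast hn
  have hvl : (v n : ℝ) ≤ Real.log n := ((div_lt_one hl0).1 hvn).le
  have hh := abs_hSeq_le v hn hl hc hM.le ht
  have hhalf : |hSeq v n t| ≤ 1 / 2 := by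
    rw [pow_one, lt_div_iff₀ (by positivity)] at hsm
    linarith
  have hL : LnSq v n t = √(1 + v n / n) * (1 + hSeq v n t) ^ 2 := by
    rw [LnSq, ← Real.sqrt_div (by positivity), add_div, div_self (by positivity)]
  have key := abs_quadratic_expansion_le (by linarith) (v n).cast_nonneg
    (hvl.trans (Real.log_le_self (by linarith))) hvl hl (by linarith) hhalf hh
  rw [phiFun, hL]
  refine key.trans ?_
  rw [lt_div_iff₀ (by positivity)] at her
  rw [le_div_iff₀ hl0]
  calc 25 * (5 + M) ^ 3 * (Real.log n ^ 3 / √n) * Real.log n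
      = Real.log n ^ 4 / √n * (25 * (5 + M) ^ 3) := by ring
    _ ≤ ε := her.le
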